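/- There is no continuous map h : S^n → S^{n-1} satisfying h(-x) = -h(x) for all x ∈ S^n. -/

import Mathlib

namespace BU
set_option linter.unusedSectionVars false
noncomputable section

/-- Mod 2 chains of ordered tuples. -/
abbrev Ch (E : Type*) := List E →₀ ZMod 2

section algebra
variable {E : Type*}

/-- basis chain -/
def sg (l : List E) : Ch E := Finsupp.single l 1

/-- linear extension -/
def ext {M : Type*} [AddCommGroup M] [Module (ZMod 2) M] (f : List E → M) : Ch E →ₗ[ZMod 2] M :=
  Finsupp.linearCombination (ZMod 2) f

@[simp] lemma ext_sg {M : Type*} [AddCommGroup M] [Module (ZMod 2) M] (f : List E → M)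
    (l : List E) : ext f (sg l) = f l := by
  simp [ext, sg]

lemma hom_ext {M : Type*} [AddCommGroup M] [Module (ZMod 2) M] {f g : Ch E →ₗ[ZMod 2] M}
    (h : ∀ l, f (sg l) = g (sg l)) : f = g := by
  apply Finsupp.lhom_ext'
  intro l
  apply LinearMap.ext_ring
  exact h l

/-- chains all of whose tuples satisfy a predicate -/
abbrev sup (S : List E → Prop) : Submodule (ZMod 2) (Ch E) :=
  Finsupp.supported (ZMod 2) (ZMod 2) {l | S l}

lemma sg_mem {S : List E → Prop} {l : List E} (h : S l) : sg l ∈ sup S :=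
  Finsupp.single_mem_supported _ _ h

lemma supp_ind {S : List E → Prop} (p : Submodule (ZMod 2) (Ch E))
    (h : ∀ l, S l → sg l ∈ p) : sup S ≤ p := by
  unfold sup
  rw [Finsupp.supported_eq_span_single, Submodule.span_le]
  rintro _ ⟨l, hl, rfl⟩
  exact h l hl

lemma supp_map {F : Type*} {S : List E → Prop} {R : List F → Prop} (f : Ch E →ₗ[ZMod 2] Ch F)
    (h : ∀ l, S l → f (sg l) ∈ sup R) {c : Ch E} (hc : c ∈ sup S) : f c ∈ sup R :=
  supp_ind ((sup R).comap f) h hc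

lemma supp_eq {M : Type*} [AddCommGroup M] [Module (ZMod 2) M] {S : List E → Prop}
    (f g : Ch E →ₗ[ZMod 2] M)
    (h : ∀ l, S l → f (sg l) = g (sg l)) {c : Ch E} (hc : c ∈ sup S) : f c = g c :=
  supp_ind (LinearMap.eqLocus f g) h hc

lemma add_self {M : Type*} [AddCommGroup M] [Module (ZMod 2) M] (x : M) : x + x = 0 := by
  rw [← two_smul (ZMod 2) x, show (2 : ZMod 2) = 0 from rfl, zero_smul]

/-- cone -/
def cone (v : E) : Ch E →ₗ[ZMod 2] Ch E := ext fun l => sg (v :: l)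

@[simp] lemma cone_sg (v : E) (l : List E) : cone v (sg l) = sg (v :: l) := by simp [cone]

/-- boundary of a tuple -/
def bdL : List E → Ch E
  | [] => 0
  | v :: l => sg l + cone v (bdL l)

/-- boundary -/
def bd : Ch E →ₗ[ZMod 2] Ch E := ext bdL

@[simp] lemma bd_sg (l : List E) : bd (sg l) = bdL l := by simp [bd]

lemma bd_cone (v : E) (c : Ch E) : bd (cone v c) = c + cone v (bd c) := by
  have : bd ∘ₗ cone v = LinearMap.id + cone v ∘ₗ bd := by
    apply hom_ext
    intro l
    simp [bdL]
  exact LinearMap.congr_fun this c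

lemma bd_bd (c : Ch E) : bd (bd c) = 0 := by
  have : (bd ∘ₗ bd : Ch E →ₗ[ZMod 2] Ch E) = 0 := by
    apply hom_ext
    intro l
    induction l with
    | nil => simp [bdL]
    | cons v l ih =>
      simp only [LinearMap.comp_apply, bd_sg, LinearMap.zero_apply] at ih ⊢
      rw [bdL, map_add, bd_sg, bd_cone, ih, map_zero, add_zero, add_self]
  exact LinearMap.congr_fun this c

lemma bdL_supp (l : List E) : bdL l ∈ sup (fun l' => l'.Sublist l ∧ l'.length + 1 = l.length) := by
  induction l with
  | nil => simp [bdL]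
  | cons v l ih =>
    rw [bdL]
    refine Submodule.add_mem _ (sg_mem ⟨List.sublist_cons_self _ _, by simp⟩) ?_
    refine supp_map _ ?_ ih
    rintro l' ⟨h1, h2⟩
    rw [cone_sg]
    exact sg_mem ⟨h1.cons_cons v, by simp [h2]⟩

/-- The cochains `U` and `W`. -/
def UW (s : ℕ → E → ZMod 2) : List E → ZMod 2 × ZMod 2
  | [] => (0, 1)
  | v :: l =>
    let u := s (l.length - 1) v * (UW s l).1 + (UW s l).2
    (u, s l.length v * u)

def U (s : ℕ → E → ZMod 2) (l : List E) : ZMod 2 := (UW s l).1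
def W (s : ℕ → E → ZMod 2) (l : List E) : ZMod 2 := (UW s l).2

variable (s : ℕ → E → ZMod 2)

lemma U_nil : U s [] = 0 := rfl
lemma W_nil : W s [] = 1 := rfl
lemma U_cons (v : E) (l : List E) : U s (v :: l) = s (l.length - 1) v * U s l + W s l := rfl
lemma W_cons (v : E) (l : List E) : W s (v :: l) = s l.length v * U s (v :: l) := rfl

lemma UW_bd (l : List E) : ext (U s) (bdL l) = 0 ∧ ext (W s) (bdL l) = U s l := by
  induction l with
  | nil => simp [bdL, U_nil]
  | cons v l ih =>
    have h1 : ext (U s) (cone v (bdL l)) = U s l := by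
      have := supp_eq (ext (U s) ∘ₗ cone v) (s (l.length - 2) v • ext (U s) + ext (W s))
        (S := fun l' => l'.Sublist l ∧ l'.length + 1 = l.length) (c := bdL l) ?_ (bdL_supp l)
      · simpa [ih.1, ih.2] using this
      · rintro l' ⟨-, h⟩
        simp [U_cons, ← h]
    have h2 : ext (W s) (cone v (bdL l)) = s (l.length - 1) v * U s l := by
      rw [← h1]
      have := supp_eq (ext (W s) ∘ₗ cone v) (s (l.length - 1) v • (ext (U s) ∘ₗ cone v))
        (S := fun l' => l'.Sublist l ∧ l'.length + 1 = l.length) (c := bdL l) ?_ (bdL_supp l)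
      · simpa using this
      · rintro l' ⟨-, h⟩
        simp [W_cons, ← h]
    constructor
    · rw [bdL, map_add, h1, ext_sg, add_self]
    · rw [bdL, map_add, h2, ext_sg, U_cons, add_comm]

lemma W_bd (c : Ch E) : ext (W s) (bd c) = ext (U s) c := by
  have : ext (W s) ∘ₗ bd = ext (U s) := by
    apply hom_ext
    intro l
    simpa using (UW_bd s l).2
  exact LinearMap.congr_fun this c

lemma U_zero (i : ℕ) (l : List E) (h : ∀ v ∈ l, ∀ w ∈ l, s i v = s i w) (hl : i + 2 ≤ l.length) :
    U s l = 0 := by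
  induction l with
  | nil => simp at hl
  | cons v l ih =>
    cases l with
    | nil => simp at hl
    | cons w l =>
      by_cases hi : i = l.length
      · rw [U_cons, W_cons, ← add_mul]
        simp only [List.length_cons, Nat.add_sub_cancel]
        rw [← hi, h v (by simp) w (by simp), add_self, zero_mul]
      · have : U s (w :: l) = 0 := by
          apply ih
          · intro a ha b hb
            exact h a (List.mem_cons_of_mem _ ha) b (List.mem_cons_of_mem _ hb)
          · simp at hl ⊢
            omega
        rw [U_cons, W_cons, this]
        simp

lemma W_zero (i : ℕ) (l : List E) (h : ∀ v ∈ l, ∀ w ∈ l, s i v = s i w) (hl : i + 2 ≤ l.length) :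
    W s l = 0 := by
  cases l with
  | nil => simp at hl
  | cons v l => rw [W_cons, U_zero s i _ h hl, mul_zero]

end algebra

section neg
variable {E : Type*} [AddCommGroup E] [Module ℝ E]

/-- antipode on chains -/
def an : Ch E →ₗ[ZMod 2] Ch E := ext fun l => sg (l.map Neg.neg)

@[simp] lemma an_sg (l : List E) : an (sg l) = sg (l.map Neg.neg) := by simp [an]

lemma an_cone (v : E) (c : Ch E) : an (cone v c) = cone (-v) (an c) := by
  have : an ∘ₗ cone v = cone (-v) ∘ₗ an := by
    apply hom_ext
    intro l
    simp
  exact LinearMap.congr_fun this c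

lemma an_bd (c : Ch E) : an (bd c) = bd (an c) := by
  have : (an ∘ₗ bd : Ch E →ₗ[ZMod 2] Ch E) = bd ∘ₗ an := by
    apply hom_ext
    intro l
    induction l with
    | nil => simp [bdL]
    | cons v l ih =>
      simp only [LinearMap.comp_apply, bd_sg, an_sg] at ih
      simp [bdL, an_cone, ih]
  exact LinearMap.congr_fun this c

lemma UW_neg (s : ℕ → E → ZMod 2) (l : List E) (h : ∀ i, ∀ v ∈ l, s i (-v) = s i v + 1) :
    U s (l.map Neg.neg) = U s l ∧ W s (l.map Neg.neg) = W s l + U s l := by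
  induction l with
  | nil => simp [U_nil, W_nil]
  | cons v l ih =>
    obtain ⟨h1, h2⟩ := ih fun i w hw => h i w (List.mem_cons_of_mem _ hw)
    have h3 : U s ((v :: l).map Neg.neg) = U s (v :: l) := by
      rw [List.map_cons, U_cons, U_cons, h1, h2, h _ v (by simp), List.length_map]
      linear_combination add_self (U s l)
    refine ⟨h3, ?_⟩
    rw [List.map_cons] at h3 ⊢
    rw [W_cons, W_cons, h3, h _ v (by simp), List.length_map]
    ring

/-- barycenter -/
def bary (l : List E) : E := (l.length : ℝ)⁻¹ • l.sum

lemma sum_neg (l : List E) : (l.map Neg.neg).sum = - l.sum := by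
  induction l with
  | nil => simp
  | cons v l ih => simp [ih, add_comm]

lemma bary_neg (l : List E) : bary (l.map Neg.neg) = - bary l := by
  simp [bary, sum_neg]

/-- subdivision of tuples of length `k` -/
def sdL : ℕ → List E → Ch E
  | 0, _ => sg []
  | k + 1, l => cone (bary l) (ext (sdL k) (bdL l))

def sd (k : ℕ) : Ch E →ₗ[ZMod 2] Ch E := ext (sdL k)

lemma bd_sd (k : ℕ) : ∀ c : Ch E, bd (sd (k + 1) c) = sd k (bd c) := by
  induction k with
  | zero =>
    intro c
    have : (bd ∘ₗ sd 1 : Ch E →ₗ[ZMod 2] Ch E) = sd 0 ∘ₗ bd := by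
      apply hom_ext
      intro l
      have h0 : (bd ∘ₗ ext (sdL 0) : Ch E →ₗ[ZMod 2] Ch E) = 0 := by
        apply hom_ext
        intro l
        simp [sdL, bdL]
      have h1 := LinearMap.congr_fun h0 (bdL l)
      simp only [LinearMap.comp_apply, LinearMap.zero_apply] at h1
      have h2 : sd 1 (sg l) = cone (bary l) (ext (sdL 0) (bdL l)) := by
        simp only [sd, ext_sg]
        rfl
      simp only [LinearMap.comp_apply]
      rw [h2, bd_cone, h1, map_zero, add_zero, bd_sg, sd]
    exact LinearMap.congr_fun this c
  | succ k ih =>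
    intro c
    have : (bd ∘ₗ sd (k + 2) : Ch E →ₗ[ZMod 2] Ch E) = sd (k + 1) ∘ₗ bd := by
      apply hom_ext
      intro l
      have h1 := ih (bdL l)
      rw [← bd_sg, bd_bd, map_zero, bd_sg] at h1
      have h2 : sd (k + 2) (sg l) = cone (bary l) (sd (k + 1) (bdL l)) := by
        simp [sd, sdL]
      simp only [LinearMap.comp_apply]
      rw [h2, bd_cone, h1, map_zero, add_zero, bd_sg]
    exact LinearMap.congr_fun this c

lemma an_sd (k : ℕ) : ∀ c : Ch E, an (sd k c) = sd k (an c) := by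
  induction k with
  | zero =>
    intro c
    have : (an ∘ₗ sd 0 : Ch E →ₗ[ZMod 2] Ch E) = sd 0 ∘ₗ an := by
      apply hom_ext
      intro l
      simp [sd, sdL]
    exact LinearMap.congr_fun this c
  | succ k ih =>
    intro c
    have : (an ∘ₗ sd (k + 1) : Ch E →ₗ[ZMod 2] Ch E) = sd (k + 1) ∘ₗ an := by
      apply hom_ext
      intro l
      have h2 : ∀ l : List E, sd (k + 1) (sg l) = cone (bary l) (sd k (bdL l)) := by
        intro l
        simp [sd, sdL]
      simp only [LinearMap.comp_apply, an_sg]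
      rw [h2, h2, an_cone, bary_neg, ih, ← bd_sg, an_bd, an_sg, bd_sg]
    exact LinearMap.congr_fun this c

/-- iterated subdivision -/
def sdI (k : ℕ) : ℕ → Ch E →ₗ[ZMod 2] Ch E
  | 0 => LinearMap.id
  | m + 1 => sd k ∘ₗ sdI k m

lemma bd_sdI (k m : ℕ) (c : Ch E) : bd (sdI (k + 1) m c) = sdI k m (bd c) := by
  induction m with
  | zero => rfl
  | succ m ih => simp [sdI, bd_sd, ih]

lemma an_sdI (k m : ℕ) (c : Ch E) : an (sdI k m c) = sdI k m (an c) := by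
  induction m with
  | zero => rfl
  | succ m ih => simp [sdI, an_sd, ih]

lemma sdI_nil (m : ℕ) : sdI 0 m (sg ([] : List E)) = sg [] := by
  induction m with
  | zero => rfl
  | succ m ih => simp [sdI, ih, sd, sdL]

/-- octahedral spheres -/
def zz (e : ℕ → E) : ℕ → Ch E
  | 0 => sg []
  | k + 1 => cone (e k) (zz e k) + cone (-e k) (zz e k)

lemma an_zz (e : ℕ → E) (k : ℕ) : an (zz e k) = zz e k := by
  induction k with
  | zero => simp [zz]
  | succ k ih => simp [zz, an_cone, ih, add_comm]

lemma bd_zz (e : ℕ → E) (k : ℕ) : bd (zz e k) = 0 := by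
  induction k with
  | zero => simp [zz, bdL]
  | succ k ih => simp [zz, bd_cone, ih, add_self]

theorem W_zz (s : ℕ → E → ZMod 2) (e : ℕ → E) (m N : ℕ)
    (hs : ∀ k < N, sdI (k + 1) m (cone (e k) (zz e k)) ∈
      sup (fun l => ∀ i, ∀ v ∈ l, s i (-v) = s i v + 1)) :
    ∀ k ≤ N, ext (W s) (sdI k m (zz e k)) = 1 := by
  intro k
  induction k with
  | zero => intro _; simp [zz, sdI_nil, W_nil]
  | succ k ih =>
    intro hk
    have h1 : zz e (k + 1) = cone (e k) (zz e k) + an (cone (e k) (zz e k)) := by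
      rw [an_cone, an_zz]; rfl
    rw [h1, map_add, ← an_sdI]
    have h2 := supp_eq (ext (W s) + ext (W s) ∘ₗ an) (ext (U s)) ?_ (hs k hk)
    · rw [LinearMap.add_apply, LinearMap.comp_apply] at h2
      rw [map_add, h2, ← W_bd, bd_sdI, bd_cone, bd_zz, map_zero, add_zero]
      exact ih (by omega)
    · intro l hl
      simp only [LinearMap.add_apply, LinearMap.comp_apply, an_sg, ext_sg]
      rw [(UW_neg s l hl).2, ← add_assoc, add_self, zero_add]

lemma bary_mem {T : Set E} (hT : Convex ℝ T) (l : List E) (hl : l ≠ []) (h : ∀ v ∈ l, v ∈ T) :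
    bary l ∈ T := by
  induction l with
  | nil => exact absurd rfl hl
  | cons v l ih =>
    by_cases h0 : l = []
    · subst h0; simpa [bary] using h
    · have h1 := ih h0 fun w hw => h w (List.mem_cons_of_mem _ hw)
      have hp : (0 : ℝ) < l.length := by
        exact_mod_cast List.length_pos_iff.2 h0
      have := hT (h v (by simp)) h1 (a := ((l.length : ℝ) + 1)⁻¹)
        (b := (l.length : ℝ) * ((l.length : ℝ) + 1)⁻¹) (by positivity) (by positivity)
        (by field_simp; ring)
      convert this using 1
      rw [bary, bary, smul_smul, List.sum_cons, smul_add, List.length_cons]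
      push_cast
      congr 2
      field_simp

lemma sdL_supp {T : Set E} (hT : Convex ℝ T) (k : ℕ) : ∀ l : List E, l.length = k →
    (∀ v ∈ l, v ∈ T) → sdL k l ∈ sup (fun l' => l'.length = k ∧ ∀ v ∈ l', v ∈ T) := by
  induction k with
  | zero => intro l _ _; exact sg_mem (by simp)
  | succ k ih =>
    intro l hl h
    have hb := bary_mem hT l (by rintro rfl; simp at hl) h
    rw [sdL]
    refine supp_map (S := fun l' => l'.length = k ∧ ∀ v ∈ l', v ∈ T) _ ?_ ?_
    · rintro l' ⟨h1, h2⟩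
      rw [cone_sg]
      refine sg_mem ⟨by simp [h1], ?_⟩
      intro v hv
      rcases List.mem_cons.1 hv with rfl | hv
      · exact hb
      · exact h2 v hv
    · refine supp_map _ ?_ (bdL_supp l)
      rintro l' ⟨h1, h2⟩
      rw [ext_sg]
      exact ih l' (by omega) fun v hv => h v (h1.subset hv)

end neg

section metric
variable {E : Type*} [NormedAddCommGroup E] [NormedSpace ℝ E]

lemma sum_bound (v : E) (D : ℝ) (l : List E) (h : ∀ w ∈ l, ‖w - v‖ ≤ D) :
    ‖l.sum - (l.length : ℝ) • v‖ ≤ l.length * D := by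
  induction l with
  | nil => simp
  | cons w l ih =>
    have h1 := ih fun x hx => h x (List.mem_cons_of_mem _ hx)
    have h2 := h w (by simp)
    have : (w :: l).sum - ((w :: l).length : ℝ) • v = (w - v) + (l.sum - (l.length : ℝ) • v) := by
      simp [add_smul]; abel
    rw [this]
    refine (norm_add_le _ _).trans ?_
    simp only [List.length_cons]
    push_cast
    linarith

lemma bary_bound {D : ℝ} (k : ℕ) (l : List E) (hl : l.length = k + 1)
    (h : ∀ v ∈ l, ∀ w ∈ l, ‖w - v‖ ≤ D) (v : E) (hv : v ∈ l) :
    ‖v - bary l‖ ≤ k / (k + 1) * D := by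
  classical
  have hp := List.perm_cons_erase hv
  have hlen : (l.erase v).length = k := by rw [List.length_erase_of_mem hv]; omega
  have hb := sum_bound v D (l.erase v) fun w hw => h v hv w (List.mem_of_mem_erase hw)
  rw [hlen] at hb
  have hs : l.sum = v + (l.erase v).sum := by rw [hp.sum_eq]; simp
  have : v - bary l = -((k + 1 : ℝ)⁻¹ • ((l.erase v).sum - (k : ℝ) • v)) := by
    rw [bary, hs, hl]
    push_cast
    have hk : (k + 1 : ℝ) ≠ 0 := by positivity
    have : v = (k + 1 : ℝ)⁻¹ • ((k + 1 : ℝ) • v) := by rw [smul_smul, inv_mul_cancel₀ hk, one_smul]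
    nth_rewrite 1 [this]
    rw [← smul_sub, ← smul_neg, add_smul, one_smul]
    congr 1
    abel
  rw [this, norm_neg, norm_smul, Real.norm_of_nonneg (by positivity), div_mul_eq_mul_div,
    inv_mul_eq_div]
  gcongr

lemma sdL_diam {D : ℝ} (hD : 0 ≤ D) (k N : ℕ) (hk : k ≤ N + 1) : ∀ l : List E, l.length = k →
    (∀ v ∈ l, ∀ w ∈ l, ‖w - v‖ ≤ D) →
    sdL k l ∈ sup (fun l' => ∀ v ∈ l', ∀ w ∈ l', ‖w - v‖ ≤ N / (N + 1) * D) := by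
  induction k with
  | zero => intro l _ _; exact sg_mem (by simp)
  | succ k ih =>
    intro l hl h
    rw [sdL]
    have hkN : (k / (k + 1) : ℝ) * D ≤ N / (N + 1) * D := by
      have : (k : ℝ) ≤ N := by exact_mod_cast Nat.le_of_succ_le_succ hk
      gcongr ?_ * _
      rw [div_le_div_iff₀ (by positivity) (by positivity)]
      nlinarith
    have hT := convex_closedBall (bary l) (k / (k + 1) * D)
    refine supp_map (S := fun l' => (∀ v ∈ l', ∀ w ∈ l', ‖w - v‖ ≤ N / (N + 1) * D) ∧
      (∀ v ∈ l', v ∈ Metric.closedBall (bary l) (k / (k + 1) * D))) _ ?_ ?_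
    · rintro l' ⟨h1, h2⟩
      rw [cone_sg]
      refine sg_mem ?_
      intro v hv w hw
      rcases List.mem_cons.1 hv with rfl | hv
      · rcases List.mem_cons.1 hw with rfl | hw
        · rw [sub_self, norm_zero]; positivity
        · exact (mem_closedBall_iff_norm.1 (h2 w hw)).trans hkN
      · rcases List.mem_cons.1 hw with rfl | hw
        · rw [norm_sub_rev]
          exact (mem_closedBall_iff_norm.1 (h2 v hv)).trans hkN
        · exact h1 v hv w hw
    · refine supp_map _ ?_ (bdL_supp l)
      rintro l' ⟨h1, h2⟩
      rw [ext_sg]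
      have a1 := ih (by omega) l' (by omega)
        fun v hv w hw => h v (h1.subset hv) w (h1.subset hw)
      have a2 := sdL_supp hT k l' (by omega) fun v hv =>
        mem_closedBall_iff_norm.2 (bary_bound k l hl h v (h1.subset hv))
      rw [Finsupp.mem_supported] at a1 a2 ⊢
      exact fun x hx => ⟨a1 hx, (a2 hx).2⟩

/-- good tuples -/
def Good (K : Set E) (k : ℕ) (D : ℝ) (l : List E) : Prop :=
  l.length = k ∧ (∃ T ⊆ K, Convex ℝ T ∧ ∀ v ∈ l, v ∈ T) ∧ ∀ v ∈ l, ∀ w ∈ l, ‖w - v‖ ≤ D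

lemma sdI_good (K : Set E) (D : ℝ) (hD : 0 ≤ D) (k N : ℕ) (hk : k ≤ N + 1) (m : ℕ) (c : Ch E)
    (hc : c ∈ sup (Good K k D)) : sdI k m c ∈ sup (Good K k ((N / (N + 1)) ^ m * D)) := by
  induction m with
  | zero => simpa [sdI] using hc
  | succ m ih =>
    rw [sdI, LinearMap.comp_apply]
    refine supp_map _ ?_ ih
    rintro l ⟨h1, ⟨T, hTK, hT, h2⟩, h3⟩
    rw [sd, ext_sg]
    have a1 := sdL_supp hT k l h1 h2
    have a2 := sdL_diam (by positivity) k N hk l h1 h3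
    rw [Finsupp.mem_supported] at a1 a2 ⊢
    intro x hx
    refine ⟨(a1 hx).1, ⟨T, hTK, hT, (a1 hx).2⟩, ?_⟩
    rw [pow_succ', mul_assoc]
    exact a2 hx

end metric

section euclid
variable {n : ℕ}

/-- standard basis -/
def ee (n : ℕ) (k : ℕ) : EuclideanSpace ℝ (Fin (n + 1)) :=
  if h : k < n + 1 then EuclideanSpace.single ⟨k, h⟩ 1 else 0

/-- octahedral sphere -/
def KK (n : ℕ) : Set (EuclideanSpace ℝ (Fin (n + 1))) := {x | ∑ i, |x i| = 1}

def Oct (n k : ℕ) (l : List (EuclideanSpace ℝ (Fin (n + 1)))) : Prop :=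
  l.length = k ∧ ∃ ε : Fin (n + 1) → ℝ, (∀ i, ε i = 1 ∨ ε i = -1) ∧
    ∀ v ∈ l, ∃ i : Fin (n + 1), i.1 < k ∧ v = EuclideanSpace.single i (ε i)

lemma oct_cons (k : ℕ) (hk : k < n + 1) (l : List (EuclideanSpace ℝ (Fin (n + 1))))
    (h : Oct n k l) (a : ℝ) (ha : a = 1 ∨ a = -1) :
    Oct n (k + 1) (EuclideanSpace.single ⟨k, hk⟩ a :: l) := by
  obtain ⟨h1, ε, h2, h3⟩ := h
  refine ⟨by simp [h1], Function.update ε ⟨k, hk⟩ a, ?_, ?_⟩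
  · intro i
    by_cases hi : i = ⟨k, hk⟩
    · subst hi; simpa using ha
    · simpa [Function.update_of_ne hi] using h2 i
  · intro v hv
    rcases List.mem_cons.1 hv with rfl | hv
    · exact ⟨⟨k, hk⟩, by simp, by simp⟩
    · obtain ⟨i, hi, rfl⟩ := h3 v hv
      refine ⟨i, by omega, ?_⟩
      rw [Function.update_of_ne]
      rintro rfl
      simp at hi

lemma ee_neg (k : ℕ) (hk : k < n + 1) : -ee n k = EuclideanSpace.single ⟨k, hk⟩ (-1) := by
  ext i
  simp [ee, hk, Pi.single_apply]
  split_ifs <;> simp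

lemma cone_oct (k : ℕ) (hk : k < n + 1) (h : zz (ee n) k ∈ sup (Oct n k)) :
    cone (ee n k) (zz (ee n) k) ∈ sup (Oct n (k + 1)) := by
  refine supp_map _ ?_ h
  intro l hl
  rw [cone_sg]
  refine sg_mem ?_
  have := oct_cons k hk l hl 1 (Or.inl rfl)
  simpa [ee, hk] using this

lemma zz_oct (k : ℕ) (hk : k ≤ n + 1) : zz (ee n) k ∈ sup (Oct n k) := by
  induction k with
  | zero => exact sg_mem ⟨rfl, fun _ => 1, by simp, by simp⟩
  | succ k ih =>
    refine Submodule.add_mem _ (cone_oct k hk (ih (by omega))) ?_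
    refine supp_map _ ?_ (ih (by omega))
    intro l hl
    rw [cone_sg]
    refine sg_mem ?_
    rw [ee_neg k hk]
    exact oct_cons k hk l hl (-1) (Or.inr rfl)

lemma oct_good (k : ℕ) (l : List (EuclideanSpace ℝ (Fin (n + 1)))) (h : Oct n k l) :
    Good (KK n) k 2 l := by
  obtain ⟨h1, ε, h2, h3⟩ := h
  refine ⟨h1, ⟨{x | (∀ i, 0 ≤ ε i * x i) ∧ ∑ i, ε i * x i = 1}, ?_, ?_, ?_⟩, ?_⟩
  · rintro x ⟨hx1, hx2⟩
    change ∑ i, |x i| = 1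
    rw [← hx2]
    refine Finset.sum_congr rfl fun i _ => ?_
    have := hx1 i
    rcases h2 i with h | h
    · rw [h, one_mul] at this ⊢
      exact abs_of_nonneg this
    · rw [h] at this ⊢
      rw [abs_of_nonpos (by linarith)]
      ring
  · rintro x ⟨hx1, hx2⟩ y ⟨hy1, hy2⟩ a b ha hb hab
    have key : ∀ i, ε i * (a • x + b • y) i = a * (ε i * x i) + b * (ε i * y i) := by
      intro i
      simp
      ring
    refine ⟨?_, ?_⟩
    · intro i
      rw [key]
      have := hx1 i
      have := hy1 i
      positivity
    · simp_rw [key]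
      rw [Finset.sum_add_distrib, ← Finset.mul_sum, ← Finset.mul_sum, hx2, hy2]
      linarith
  · intro v hv
    obtain ⟨i, -, rfl⟩ := h3 v hv
    have hs : ε i * ε i = 1 := by rcases h2 i with h | h <;> simp [h]
    refine ⟨?_, ?_⟩
    · intro j
      by_cases hj : j = i
      · subst hj; simp [hs]
      · simp [hj]
    · rw [Finset.sum_eq_single i]
      · simp [hs]
      · intro j _ hj
        simp [hj]
      · simp
  · have hn : ∀ v ∈ l, ‖v‖ ≤ 1 := by
      intro v hv
      obtain ⟨i, -, rfl⟩ := h3 v hv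
      rcases h2 i with h | h <;> simp [h]
    intro v hv w hw
    have := norm_sub_le w v
    linarith [hn v hv, hn w hw]

lemma KK_ne {x : EuclideanSpace ℝ (Fin (n + 1))} (hx : x ∈ KK n) : x ≠ 0 := by
  rintro rfl
  simp [KK] at hx

lemma KK_compact : IsCompact (KK n) := by
  apply Metric.isCompact_of_isClosed_isBounded
  · apply isClosed_eq <;> fun_prop
  · refine (Metric.isBounded_iff_subset_closedBall 0).2 ⟨Real.sqrt (n + 1), ?_⟩
    intro x hx
    rw [mem_closedBall_zero_iff, EuclideanSpace.norm_eq]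
    apply Real.sqrt_le_sqrt
    calc ∑ i, ‖x i‖ ^ 2 ≤ ∑ i : Fin (n + 1), (1 : ℝ) := by
          refine Finset.sum_le_sum fun i _ => ?_
          have h1 : |x i| ≤ 1 := by
            rw [← show ∑ i, |x i| = 1 from hx]
            exact Finset.single_le_sum (f := fun i => |x i|) (fun _ _ => abs_nonneg _)
              (Finset.mem_univ i)
          rw [Real.norm_eq_abs]
          exact pow_le_one₀ (abs_nonneg _) h1
      _ = n + 1 := by simp

lemma exists_sign (E : Type*) [AddCommGroup E] [Module ℝ E] :
    ∃ t : E → ZMod 2, ∀ x, x ≠ 0 → t (-x) = t x + 1 := by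
  classical
  refine ⟨fun x => if WellOrderingRel x (-x) then 1 else 0, ?_⟩
  intro x hx
  have hne : x ≠ -x := by
    intro h
    apply hx
    have h2 : (2 : ℝ) • x = 0 := by
      rw [two_smul]
      nth_rewrite 1 [h]
      simp
    simpa using h2
  simp only [neg_neg]
  rcases trichotomous_of WellOrderingRel x (-x) with h | h | h
  · rw [if_neg (asymm h), if_pos h]; rfl
  · exact absurd h hne
  · rw [if_pos h, if_neg (asymm h)]; rfl

lemma exists_large (y : EuclideanSpace ℝ (Fin n)) (hy : ‖y‖ = 1) : ∃ i, 1 / (n + 1 : ℝ) ≤ |y i| := by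
  by_contra! hc
  have h1 : ∑ i, ‖y i‖ ^ 2 = 1 := by
    rw [← EuclideanSpace.norm_sq_eq, hy]; norm_num
  have h2 : ∑ i, ‖y i‖ ^ 2 ≤ ∑ i : Fin n, (1 / (n + 1 : ℝ)) := by
    refine Finset.sum_le_sum fun i _ => ?_
    rw [Real.norm_eq_abs]
    have h3 := hc i
    have h4 : 1 / (n + 1 : ℝ) ≤ 1 := by
      rw [div_le_one (by positivity)]
      linarith [(Nat.cast_nonneg n : (0 : ℝ) ≤ n)]
    nlinarith [abs_nonneg (y i)]
  rw [h1] at h2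
  simp at h2
  rw [← div_eq_mul_inv, le_div_iff₀ (by positivity)] at h2
  linarith

theorem main (n : ℕ) (g : EuclideanSpace ℝ (Fin (n + 1)) → EuclideanSpace ℝ (Fin n))
    (hg : ContinuousOn g (KK n)) (h1 : ∀ x ∈ KK n, ‖g x‖ = 1)
    (hodd : ∀ x ∈ KK n, g (-x) = -g x) : False := by
  classical
  obtain ⟨t, ht⟩ := exists_sign (EuclideanSpace ℝ (Fin (n + 1)))
  let s : ℕ → EuclideanSpace ℝ (Fin (n + 1)) → ZMod 2 := fun i x =>
    if h : i < n then (if 0 < g x ⟨i, h⟩ then 1 else if g x ⟨i, h⟩ < 0 then 0 else t x) else t x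
  have hs : ∀ x ∈ KK n, ∀ i, s i (-x) = s i x + 1 := by
    intro x hx i
    have htx := ht x (KK_ne hx)
    simp only [s]
    by_cases hi : i < n
    · simp only [hi, dite_true, hodd x hx, PiLp.neg_apply]
      rcases lt_trichotomy (g x ⟨i, hi⟩) 0 with h | h | h
      · simp [h, h.le, not_lt.2 h.le]
      · simp [h, htx]
      · simp only [Left.neg_pos_iff, not_lt.2 h.le, if_false, Left.neg_neg_iff, h, if_true]
        rfl
    · simp [hi, htx]
  have huc := KK_compact.uniformContinuousOn_of_continuous hg
  rw [Metric.uniformContinuousOn_iff] at huc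
  obtain ⟨δ, hδ, hd⟩ := huc (1 / (n + 1 : ℝ)) (by positivity)
  obtain ⟨m, hm⟩ : ∃ m : ℕ, ((n : ℝ) / (n + 1)) ^ m * 2 < δ := by
    obtain ⟨m, hm⟩ := exists_pow_lt_of_lt_one (half_pos hδ)
      (show (n : ℝ) / (n + 1) < 1 by rw [div_lt_one (by positivity)]; linarith)
    exact ⟨m, by linarith⟩
  have hW := W_zz s (ee n) m (n + 1) ?_ (n + 1) le_rfl
  · have hz := sdI_good (KK n) 2 (by norm_num) (n + 1) n le_rfl m (zz (ee n) (n + 1))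
      (supp_ind _ (fun l hl => sg_mem (oct_good _ l hl)) (zz_oct (n + 1) le_rfl))
    have := supp_eq (ext (W s)) 0 ?_ hz
    · rw [hW] at this
      exact one_ne_zero this
    · rintro l ⟨a1, ⟨T, hTK, -, a2⟩, a3⟩
      rw [ext_sg, LinearMap.zero_apply]
      obtain ⟨v, hv⟩ : ∃ v, v ∈ l := List.exists_mem_of_length_pos (by omega)
      obtain ⟨i, hi⟩ := exists_large (g v) (h1 v (hTK (a2 v hv)))
      have hclose : ∀ w ∈ l, |g w i - g v i| < 1 / (n + 1 : ℝ) := by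
        intro w hw
        have h2 := hd w (hTK (a2 w hw)) v (hTK (a2 v hv))
          (by rw [dist_eq_norm]; exact (a3 v hv w hw).trans_lt hm)
        rw [dist_eq_norm] at h2
        have h3 := PiLp.norm_apply_le (g w - g v) i
        rw [PiLp.sub_apply, Real.norm_eq_abs] at h3
        exact h3.trans_lt h2
      have hconst : ∀ w ∈ l, s i w = if 0 < g v i then 1 else 0 := by
        intro w hw
        have h2 := hclose w hw
        simp only [s, i.2, dite_true]
        change (if 0 < g w i then (1 : ZMod 2) else if g w i < 0 then 0 else t w) = _
        have h0 : 0 < 1 / (n + 1 : ℝ) := by positivity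
        rw [abs_lt] at h2
        rcases le_abs.1 hi with h | h
        · rw [if_pos (by linarith), if_pos (by linarith)]
        · rw [if_neg (by linarith), if_pos (by linarith), if_neg (by linarith)]
      refine W_zero s i l ?_ (by have := i.2; omega)
      intro a ha b hb
      rw [hconst a ha, hconst b hb]
  · intro k hk
    have hz := sdI_good (KK n) 2 (by norm_num) (k + 1) n (by omega) m
      (cone (ee n k) (zz (ee n) k))
      (supp_ind _ (fun l hl => sg_mem (oct_good _ l hl)) (cone_oct k hk (zz_oct k (by omega))))
    refine supp_ind _ (fun l hl => sg_mem ?_) hz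
    obtain ⟨-, ⟨T, hTK, -, a2⟩, -⟩ := hl
    exact fun i v hv => hs v (hTK (a2 v hv)) i

end euclid
end
end BU


theorem stmt18 (n : ℕ) :
    ¬∃ h : EuclideanSpace ℝ (Fin (n + 1)) → EuclideanSpace ℝ (Fin n),
      ContinuousOn h (Metric.sphere 0 1) ∧
      (∀ x ∈ Metric.sphere (0 : EuclideanSpace ℝ (Fin (n + 1))) 1,
        h x ∈ Metric.sphere (0 : EuclideanSpace ℝ (Fin n)) 1) ∧
      (∀ x ∈ Metric.sphere (0 : EuclideanSpace ℝ (Fin (n + 1))) 1, h (-x) = -h x) := by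
  rintro ⟨h, hc, h1, hodd⟩
  have hmem : ∀ x ∈ BU.KK n, ‖x‖⁻¹ • x ∈
      Metric.sphere (0 : EuclideanSpace ℝ (Fin (n + 1))) 1 := by
    intro x hx
    have := norm_ne_zero_iff.2 (BU.KK_ne hx)
    rw [mem_sphere_zero_iff_norm, norm_smul, norm_inv, norm_norm, inv_mul_cancel₀ this]
  refine BU.main n (fun x => h (‖x‖⁻¹ • x)) ?_ ?_ ?_
  · refine hc.comp ?_ hmem
    refine ContinuousOn.smul (ContinuousOn.inv₀ continuous_norm.continuousOn ?_) continuousOn_id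
    intro x hx
    exact norm_ne_zero_iff.2 (BU.KK_ne hx)
  · intro x hx
    simpa using h1 _ (hmem x hx)
  · intro x hx
    simp only [norm_neg, smul_neg]
    exact hodd _ (hmem x hx)
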